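/- arXiv:2110.03313 — 2 statements merged into one kernel-verified Lean document; each statement's English description precedes it below -/
import Mathlib

section
/- Fix x, y ∈ ℝ^d. Let Q^serv be an unbiased compressor with parameter q^serv and, for m = 1,…,M, let Q_m^dev be unbiased compressors with parameters q_m^dev; assume all these compressor evaluations are mutually independent. Then E[‖Q^serv[(1/M)·∑_{m=1}^M Q_m^dev(F_m(x) − F_m(y))]‖²] ≤ C_q²·‖x − y‖², where C_q² := (q^serv/M²)·∑_{m=1}^M (q_m^dev·L_m² + (M−1)·L̃²). -/
open MeasureTheory ProbabilityTheory Finset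
open scoped RealInnerProductSpace ENNReal

namespace ProbabilityTheory

variable {Ω : Type*} [MeasurableSpace Ω] {P : Measure Ω} [IsProbabilityMeasure P]

/-- Jensen's inequality for the squared norm. -/
lemma norm_integral_sq_le {E : Type*} [NormedAddCommGroup E] [NormedSpace ℝ E]
    {X : Ω → E} (h : MemLp X 2 P) :
    ‖∫ ω, X ω ∂P‖ ^ 2 ≤ ∫ ω, ‖X ω‖ ^ 2 ∂P := by
  have hv := variance_nonneg (fun ω ↦ ‖X ω‖) P
  rw [variance_eq_sub h.norm] at hv
  have hn := norm_integral_le_integral_norm (μ := P) X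
  have := pow_le_pow_left₀ (norm_nonneg _) hn 2
  simp only [Pi.pow_apply] at hv
  linarith

variable {E : Type*} [NormedAddCommGroup E] [MeasurableSpace E] [BorelSpace E]

/-- If the sum of two independent random variables is square integrable, so is each summand. -/
lemma IndepFun.memLp_two_left_of_add [SecondCountableTopology E] {X Y : Ω → E} (hXY : X ⟂ᵢ[P] Y)
    (hX : AEMeasurable X P) (hY : AEMeasurable Y P) (h : MemLp (X + Y) 2 P) :
    MemLp X 2 P := by
  have := Measure.isProbabilityMeasure_map hX
  have := Measure.isProbabilityMeasure_map hY
  have hsum : Integrable (fun z : E × E ↦ ‖z.1 + z.2‖ ^ 2) ((P.map X).prod (P.map Y)) := by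
    rw [← hXY.map_prod_eq_prod_map_map hX hY,
      integrable_map_measure (by fun_prop) (hX.prodMk hY)]
    exact (memLp_two_iff_integrable_sq_norm h.1).1 h
  obtain ⟨y, hy⟩ := hsum.prod_left_ae.exists
  have hadd : MemLp (fun x : E ↦ x + y) 2 (P.map X) :=
    (memLp_two_iff_integrable_sq_norm (by fun_prop)).2 hy
  have hid : MemLp (fun x : E ↦ x) 2 (P.map X) := by
    simpa [Pi.sub_def] using hadd.sub (memLp_const y)
  exact (memLp_map_measure_iff (by fun_prop) hX).1 hid

/-- If the sum of finitely many independent random variables is square integrable, so is each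
summand. -/
lemma iIndepFun.memLp_two_of_sum [SecondCountableTopology E] {ι : Type*} [Fintype ι]
    {X : ι → Ω → E}
    (hX : iIndepFun X P) (hm : ∀ i, AEMeasurable (X i) P)
    (h : MemLp (∑ i, X i) 2 P) (i : ι) : MemLp (X i) 2 P := by
  classical
  rw [← Finset.add_sum_erase _ _ (Finset.mem_univ i)] at h
  refine IndepFun.memLp_two_left_of_add ?_ (hm i) (Finset.aemeasurable_sum _ fun j _ ↦ hm j) h
  exact (hX.indepFun_finsetSum_of_notMem₀ hm (Finset.notMem_erase i _)).symm

variable [InnerProductSpace ℝ E]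

/-- Second moment of a sum of independent square-integrable random vectors. -/
lemma iIndepFun.integral_norm_sum_sq [CompleteSpace E] {ι : Type*} [Fintype ι]
    {X : ι → Ω → E}
    (hX : iIndepFun X P) (h : ∀ i, MemLp (X i) 2 P) :
    ∫ ω, ‖∑ i, X i ω‖ ^ 2 ∂P =
      ∑ i, (∫ ω, ‖X i ω‖ ^ 2 ∂P - ‖∫ ω, X i ω ∂P‖ ^ 2) + ‖∑ i, ∫ ω, X i ω ∂P‖ ^ 2 := by
  classical
  have hL1 (i : ι) : Integrable (X i) P := (h i).integrable (by norm_num)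
  have hint (i j : ι) : Integrable (fun ω ↦ ⟪X i ω, X j ω⟫) P := by
    by_cases hij : i = j
    · subst hij
      simpa using (memLp_two_iff_integrable_sq_norm (h i).1).1 (h i)
    · exact (hX.indepFun hij).integrable_bilin (hL1 i) (hL1 j) (innerSL ℝ)
  have hcov (i j : ι) : ∫ ω, ⟪X i ω, X j ω⟫ ∂P =
      (if i = j then ∫ ω, ‖X i ω‖ ^ 2 ∂P - ‖∫ ω, X i ω ∂P‖ ^ 2 else 0) +
        ⟪∫ ω, X i ω ∂P, ∫ ω, X j ω ∂P⟫ := by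
    by_cases hij : i = j
    · subst hij
      simp
    · rw [if_neg hij, zero_add]
      exact (hX.indepFun hij).integral_bilin (hL1 i) (hL1 j) (innerSL ℝ)
  simp_rw [← real_inner_self_eq_norm_sq (∑ i, _), sum_inner, inner_sum]
  rw [integral_finsetSum _ fun i _ ↦ integrable_finsetSum _ fun j _ ↦ hint i j]
  simp_rw [integral_finsetSum Finset.univ fun j _ ↦ hint _ j, hcov, Finset.sum_add_distrib]
  simp

/-- Feeding an independent random input `X` to a compressor whose output is square integrable:
the input is then square integrable and the second moment grows by at most the factor `q`. -/
lemma memLp_and_integral_norm_sq_le_of_unbiased [SecondCountableTopology E]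
    {Ω' : Type*} [MeasurableSpace Ω']
    {μ : Measure Ω'} [IsProbabilityMeasure μ] {Q : E → Ω' → E} {q : ℝ}
    (hQ : Measurable (Function.uncurry Q)) (hunb : ∀ z, ∫ ω, Q z ω ∂μ = z)
    (hmom : ∀ z, ∫ ω, ‖Q z ω‖ ^ 2 ∂μ ≤ q * ‖z‖ ^ 2)
    {X : Ω → E} (hX : AEStronglyMeasurable X P)
    (hint : Integrable (fun p : Ω × Ω' ↦ ‖Q (X p.1) p.2‖ ^ 2) (P.prod μ)) :
    MemLp X 2 P ∧
      ∫ p, ‖Q (X p.1) p.2‖ ^ 2 ∂(P.prod μ) ≤ q * ∫ ω, ‖X ω‖ ^ 2 ∂P := by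
  have hL : MemLp X 2 P := by
    rw [memLp_two_iff_integrable_sq_norm hX]
    refine hint.integral_prod_left.mono' (by fun_prop) ?_
    filter_upwards [hint.prod_right_ae] with ω hω
    have hm : Measurable (Q (X ω)) := hQ.comp measurable_prodMk_left
    have := norm_integral_sq_le
      ((memLp_two_iff_integrable_sq_norm hm.aestronglyMeasurable).2 hω)
    rw [hunb] at this
    simpa using this
  refine ⟨hL, ?_⟩
  rw [integral_prod _ hint, ← integral_const_mul]
  exact integral_mono hint.integral_prod_left
    (((memLp_two_iff_integrable_sq_norm hX).1 hL).const_mul q) fun ω ↦ hmom (X ω)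

end ProbabilityTheory

/-- **Second-moment bound for the composed compressor** (key estimate in the MASHA1
analysis): for fixed `x, y`,
`E‖Q^serv[(1/M)·∑_m Q_m^dev(F_m(x) - F_m(y))]‖² ≤ C_q²·‖x - y‖²`, where the
expectation is over the (mutually independent) compressor randomness. -/
theorem masha1_compressed_second_moment
    {d M : ℕ} (hM : 0 < M)
    -- the operators
    (Fm : Fin M → EuclideanSpace ℝ (Fin d) → EuclideanSpace ℝ (Fin d))
    (F : EuclideanSpace ℝ (Fin d) → EuclideanSpace ℝ (Fin d))
    (hFdef : ∀ x, F x = (M : ℝ)⁻¹ • ∑ m, Fm m x)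
    -- Lipschitz assumptions
    (L : ℝ) (Lm : Fin M → ℝ)
    (hLipF : LipschitzWith (Real.toNNReal L) F)
    (hLipFm : ∀ m, LipschitzWith (Real.toNNReal (Lm m)) (Fm m))
    (Ltilde : ℝ) (hLt : Ltilde = Real.sqrt ((M : ℝ)⁻¹ * ∑ m, Lm m ^ 2))
    -- unbiased compressors: server with parameter `q^serv`, devices with `q_m^dev`;
    -- all evaluations are mutually independent (product randomness)
    {Ωs Ωd : Type*} [MeasurableSpace Ωs] [MeasurableSpace Ωd]
    (μs : Measure Ωs) (μd : Measure Ωd)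
    [IsProbabilityMeasure μs] [IsProbabilityMeasure μd]
    (Qserv : EuclideanSpace ℝ (Fin d) → Ωs → EuclideanSpace ℝ (Fin d))
    (Qdev : Fin M → EuclideanSpace ℝ (Fin d) → Ωd → EuclideanSpace ℝ (Fin d))
    (qserv : ℝ) (qdev : Fin M → ℝ)
    (hqserv : 1 ≤ qserv) (hqdev : ∀ m, 1 ≤ qdev m)
    (hQservMeas : Measurable (Function.uncurry Qserv))
    (hQdevMeas : ∀ m, Measurable (Function.uncurry (Qdev m)))
    (hQservUnbiased : ∀ x, ∫ ω, Qserv x ω ∂μs = x)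
    (hQservMoment : ∀ x, ∫ ω, ‖Qserv x ω‖ ^ 2 ∂μs ≤ qserv * ‖x‖ ^ 2)
    (hQdevUnbiased : ∀ m x, ∫ ω, Qdev m x ω ∂μd = x)
    (hQdevMoment : ∀ m x, ∫ ω, ‖Qdev m x ω‖ ^ 2 ∂μd ≤ qdev m * ‖x‖ ^ 2)
    (Cq : ℝ)
    (hCq : Cq = Real.sqrt (qserv / (M : ℝ) ^ 2 *
      ∑ m, (qdev m * Lm m ^ 2 + ((M : ℝ) - 1) * Ltilde ^ 2)))
    (x y : EuclideanSpace ℝ (Fin d)) :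
    ∫ p, ‖Qserv ((M : ℝ)⁻¹ • ∑ m, Qdev m (Fm m x - Fm m y) (p.1 m)) p.2‖ ^ 2
        ∂((Measure.pi fun _ : Fin M => μd).prod μs) ≤
      Cq ^ 2 * ‖x - y‖ ^ 2 := by
  set X : Fin M → Ωd → EuclideanSpace ℝ (Fin d) := fun m ↦ Qdev m (Fm m x - Fm m y)
  set P : Measure (Fin M → Ωd) := Measure.pi fun _ ↦ μd
  have hMpos : (0 : ℝ) < M := by exact_mod_cast hM
  have hM1 : (1 : ℝ) ≤ M := by exact_mod_cast hM
  have hXm (m : Fin M) : Measurable (X m) := (hQdevMeas m).comp measurable_prodMk_left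
  have hLsum : 0 ≤ (M : ℝ)⁻¹ * ∑ m, Lm m ^ 2 := by positivity
  have hLt2 : (M : ℝ) * Ltilde ^ 2 = ∑ m, Lm m ^ 2 := by
    rw [hLt, Real.sq_sqrt hLsum]
    field_simp
  have hCq2 : Cq ^ 2 =
      qserv / (M : ℝ) ^ 2 * ∑ m, (qdev m * Lm m ^ 2 + ((M : ℝ) - 1) * Ltilde ^ 2) := by
    rw [hCq, Real.sq_sqrt]
    refine mul_nonneg (by positivity) (Finset.sum_nonneg fun m _ ↦ ?_)
    have := hqdev m
    have := sub_nonneg.2 hM1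
    positivity
  by_cases hint : Integrable (fun p : (Fin M → Ωd) × Ωs ↦
      ‖Qserv ((M : ℝ)⁻¹ • ∑ m, X m (p.1 m)) p.2‖ ^ 2) (P.prod μs)
  swap
  · rw [integral_undef hint]
    positivity
  have hSm : Measurable fun ω : Fin M → Ωd ↦ (M : ℝ)⁻¹ • ∑ m, X m (ω m) := by
    fun_prop
  obtain ⟨hS, hle⟩ := memLp_and_integral_norm_sq_le_of_unbiased hQservMeas hQservUnbiased
    hQservMoment hSm.aestronglyMeasurable hint
  have hind : iIndepFun (fun m (ω : Fin M → Ωd) ↦ X m (ω m)) P :=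
    iIndepFun_pi fun m ↦ (hXm m).aemeasurable
  have hsum : MemLp (∑ m, fun ω : Fin M → Ωd ↦ X m (ω m)) 2 P := by
    have heq : (∑ m, fun ω : Fin M → Ωd ↦ X m (ω m)) =
        (M : ℝ) • fun ω : Fin M → Ωd ↦ (M : ℝ)⁻¹ • ∑ m, X m (ω m) := by
      ext1 ω
      simp [smul_smul, hMpos.ne']
    rw [heq]
    exact hS.const_smul (M : ℝ)
  have hXL := hind.memLp_two_of_sum
    (fun m ↦ ((hXm m).comp (measurable_pi_apply m)).aemeasurable) hsum
  have hmean (m : Fin M) : ∫ ω, X m (ω m) ∂P = Fm m x - Fm m y := by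
    rw [integral_comp_eval (hXm m).aestronglyMeasurable]
    exact hQdevUnbiased m _
  have hsecond (m : Fin M) : ∫ ω, ‖X m (ω m)‖ ^ 2 ∂P ≤ qdev m * ‖Fm m x - Fm m y‖ ^ 2 := by
    have hcomp : ∫ ω, ‖X m (ω m)‖ ^ 2 ∂P = ∫ ω, ‖X m ω‖ ^ 2 ∂μd :=
      integral_comp_eval (μ := fun _ : Fin M ↦ μd) (f := fun ω ↦ ‖X m ω‖ ^ 2)
        ((hXm m).norm.pow_const 2).aestronglyMeasurable
    rw [hcomp]
    exact hQdevMoment m _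
  have hlip (m : Fin M) : ‖Fm m x - Fm m y‖ ^ 2 ≤ Lm m ^ 2 * ‖x - y‖ ^ 2 := by
    have h1 := (hLipFm m).dist_le_mul x y
    rw [dist_eq_norm, dist_eq_norm, Real.coe_toNNReal'] at h1
    have h2 : max (Lm m) 0 ≤ |Lm m| := max_le (le_abs_self _) (abs_nonneg _)
    calc ‖Fm m x - Fm m y‖ ^ 2 ≤ (|Lm m| * ‖x - y‖) ^ 2 := by gcongr; grw [h1, h2]
      _ = _ := by rw [mul_pow, sq_abs]
  have hcs : ‖∑ m, (Fm m x - Fm m y)‖ ^ 2 ≤ M * ∑ m, ‖Fm m x - Fm m y‖ ^ 2 := by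
    grw [norm_sum_le]
    simpa using sq_sum_le_card_mul_sum_sq (s := Finset.univ) (f := fun m ↦ ‖Fm m x - Fm m y‖)
  have hmain : ∫ ω, ‖∑ m, X m (ω m)‖ ^ 2 ∂P ≤
      (∑ m, (qdev m * Lm m ^ 2 + ((M : ℝ) - 1) * Ltilde ^ 2)) * ‖x - y‖ ^ 2 := by
    rw [hind.integral_norm_sum_sq hXL]
    simp_rw [hmean]
    calc _ ≤ ∑ m, (qdev m * ‖Fm m x - Fm m y‖ ^ 2 - ‖Fm m x - Fm m y‖ ^ 2) +
          M * ∑ m, ‖Fm m x - Fm m y‖ ^ 2 := by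
          gcongr with m
          exact hsecond m
      _ = ∑ m, (qdev m + (M - 1)) * ‖Fm m x - Fm m y‖ ^ 2 := by
          rw [Finset.mul_sum, ← Finset.sum_add_distrib]
          exact Finset.sum_congr rfl fun m _ ↦ by ring
      _ ≤ ∑ m, (qdev m + (M - 1)) * (Lm m ^ 2 * ‖x - y‖ ^ 2) := by
          gcongr with m
          · linarith [hqdev m]
          · exact hlip m
      _ = (∑ m, qdev m * Lm m ^ 2 + (M - 1) * ∑ m, Lm m ^ 2) * ‖x - y‖ ^ 2 := by
          rw [Finset.mul_sum, ← Finset.sum_add_distrib, Finset.sum_mul]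
          exact Finset.sum_congr rfl fun m _ ↦ by ring
      _ = _ := by
          rw [← hLt2, Finset.sum_add_distrib]
          simp only [Finset.sum_const, Finset.card_univ, Fintype.card_fin, nsmul_eq_mul]
          ring
  calc _ ≤ qserv * ∫ ω, ‖(M : ℝ)⁻¹ • ∑ m, X m (ω m)‖ ^ 2 ∂P := hle
    _ = qserv / (M : ℝ) ^ 2 * ∫ ω, ‖∑ m, X m (ω m)‖ ^ 2 ∂P := by
        simp_rw [norm_smul, mul_pow, integral_const_mul]
        simp
        ring
    _ ≤ _ := by
        rw [hCq2, mul_assoc]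
        gcongr
end

section
/- Let δ ≥ 1, C ≥ 0 and K ∈ ℕ. Let (a_k)_{k=0}^{K−1}, (b_k)_{k=0}^{K−1} and (p_k)_{k=0}^{K−1} be nonnegative real sequences such that a_k ≤ C·∑_{j=0}^{k−1} (1 − 1/(2δ))^{k−1−j}·b_j for every k, and p_k ≤ p_j·(1 + 1/(4δ))^{k−j} for all 0 ≤ j ≤ k ≤ K−1. Then ∑_{k=0}^{K−1} p_k·a_k ≤ 8δ·C·∑_{k=0}^{K−1} p_k·b_k. -/
open Finset

theorem sum_range_succ_geom_convolution (s : ℝ) (c : ℕ → ℝ) (k : ℕ) :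
    ∑ j ∈ range (k + 1), s ^ (k + 1 - 1 - j) * c j =
      s * ∑ j ∈ range k, s ^ (k - 1 - j) * c j + c k := by
  rw [sum_range_succ, mul_sum]
  congr 1
  · refine sum_congr rfl fun j hj => ?_
    have hjk : j < k := mem_range.mp hj
    rw [show k + 1 - 1 - j = (k - 1 - j) + 1 by omega, pow_succ]
    ring
  · simp

/-- Summing a geometric convolution telescopes. -/
theorem one_sub_mul_sum_geom_convolution (s : ℝ) (c : ℕ → ℝ) (K : ℕ) :
    (1 - s) * ∑ k ∈ range K, ∑ j ∈ range k, s ^ (k - 1 - j) * c j +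
      ∑ j ∈ range K, s ^ (K - 1 - j) * c j = ∑ j ∈ range K, c j := by
  induction K with
  | zero => simp
  | succ K ih =>
    rw [sum_range_succ_geom_convolution, sum_range_succ _ K, sum_range_succ c, ← ih]
    ring

theorem one_sub_mul_sum_geom_convolution_le {s : ℝ} (hs : 0 ≤ s) {c : ℕ → ℝ} {K : ℕ}
    (hc : ∀ j < K, 0 ≤ c j) :
    (1 - s) * ∑ k ∈ range K, ∑ j ∈ range k, s ^ (k - 1 - j) * c j ≤ ∑ j ∈ range K, c j := by
  rw [← one_sub_mul_sum_geom_convolution s c K]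
  exact le_add_of_nonneg_right
    (sum_nonneg fun j hj => mul_nonneg (pow_nonneg hs _) (hc j (mem_range.mp hj)))

/-- Trading the growth of a weight against a geometric decay. -/
theorem weight_mul_pow_le {q r s x y : ℝ} (hq : 0 ≤ q) (hr : 0 ≤ r) (hqr : q * r ≤ s)
    (hy : 0 ≤ y) {n : ℕ} (hxy : x ≤ y * q ^ (n + 1)) : x * r ^ n ≤ q * (s ^ n * y) :=
  calc
    x * r ^ n ≤ y * q ^ (n + 1) * r ^ n := by gcongr
    _ = q * ((q * r) ^ n * y) := by ring
    _ ≤ q * (s ^ n * y) := by gcongr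

/-- **Weighted geometric absorption lemma** (the deterministic mechanism by which the
error-feedback error sequences are absorbed in the MASHA2 convergence proofs): if
`a_k ≤ C·∑_{j<k} (1 - 1/(2δ))^{k-1-j}·b_j` and the weights satisfy
`p_k ≤ p_j·(1 + 1/(4δ))^{k-j}`, then `∑_{k<K} p_k·a_k ≤ 8δC·∑_{k<K} p_k·b_k`. -/
theorem weighted_geometric_absorption
    (δ C : ℝ) (hδ : 1 ≤ δ) (hC : 0 ≤ C) (K : ℕ)
    (a b p : ℕ → ℝ)
    (ha0 : ∀ k < K, 0 ≤ a k) (hb0 : ∀ k < K, 0 ≤ b k) (hp0 : ∀ k < K, 0 ≤ p k)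
    (hrec : ∀ k < K,
      a k ≤ C * ∑ j ∈ Finset.range k, (1 - 1 / (2 * δ)) ^ (k - 1 - j) * b j)
    (hp : ∀ j k, j ≤ k → k < K → p k ≤ p j * (1 + 1 / (4 * δ)) ^ (k - j)) :
    ∑ k ∈ Finset.range K, p k * a k ≤
      8 * δ * C * ∑ k ∈ Finset.range K, p k * b k := by
  set u : ℝ := 1 / (4 * δ) with hu
  have hδ0 : 0 < δ := by linarith
  have huδ : u * δ = 1 / 4 := by rw [hu]; field_simp
  have hu0 : 0 < u := by positivity
  have hu1 : u ≤ 1 / 4 := by nlinarith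
  have hr : 1 - 1 / (2 * δ) = 1 - 2 * u := by rw [hu]; field_simp; ring
  rw [hr] at hrec
  have hterm : ∀ k < K, p k * a k ≤
      C * (1 + u) * ∑ j ∈ range k, (1 - u) ^ (k - 1 - j) * (p j * b j) := by
    intro k hk
    calc
      p k * a k ≤ p k * (C * ∑ j ∈ range k, (1 - 2 * u) ^ (k - 1 - j) * b j) :=
        mul_le_mul_of_nonneg_left (hrec k hk) (hp0 k hk)
      _ = C * ∑ j ∈ range k, p k * (1 - 2 * u) ^ (k - 1 - j) * b j := by
        rw [mul_left_comm, mul_sum]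
        simp only [mul_assoc]
      _ ≤ C * ∑ j ∈ range k, (1 + u) * ((1 - u) ^ (k - 1 - j) * p j) * b j := by
        refine mul_le_mul_of_nonneg_left (sum_le_sum fun j hj => ?_) hC
        have hjk : j < k := mem_range.mp hj
        have hpj := hp j k hjk.le hk
        rw [show k - j = (k - 1 - j) + 1 by omega] at hpj
        exact mul_le_mul_of_nonneg_right
          (weight_mul_pow_le (by linarith) (by linarith) (by nlinarith)
            (hp0 j (hjk.trans hk)) hpj) (hb0 j (hjk.trans hk))
      _ = C * (1 + u) * ∑ j ∈ range k, (1 - u) ^ (k - 1 - j) * (p j * b j) := by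
        rw [mul_assoc, mul_sum (range k) _ (1 + u)]
        simp only [mul_assoc]
  have hc : ∀ j < K, 0 ≤ p j * b j := fun j hj => mul_nonneg (hp0 j hj) (hb0 j hj)
  have hS := one_sub_mul_sum_geom_convolution_le (s := 1 - u) (by linarith) hc
  rw [sub_sub_cancel] at hS
  set S := ∑ k ∈ range K, ∑ j ∈ range k, (1 - u) ^ (k - 1 - j) * (p j * b j)
  set P := ∑ k ∈ range K, p k * b k
  have hP : 0 ≤ P := sum_nonneg fun j hj => hc j (mem_range.mp hj)
  calc
    ∑ k ∈ range K, p k * a k ≤ C * (1 + u) * S := by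
      rw [mul_sum]
      exact sum_le_sum fun k hk => hterm k (mem_range.mp hk)
    _ = C * (1 + u) * (4 * δ) * (u * S) := by linear_combination -4 * C * (1 + u) * S * huδ
    _ ≤ C * (1 + u) * (4 * δ) * P := by gcongr
    _ ≤ C * 2 * (4 * δ) * P := by
      gcongr
      linarith
    _ = 8 * δ * C * P := by ring
end
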